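/- Let p ≥ 1, L ≥ 1, and let Σ₀ be a p×p real symmetric positive definite matrix whose inverse Θ₀ := Σ₀⁻¹ satisfies 1/L ≤ λ_min(Θ₀) ≤ λ_max(Θ₀) ≤ L. Let Σ̂ be a p×p real symmetric matrix with ‖Σ̂ − Σ₀‖_∞ ≤ λ₀ for some λ₀ > 0. Let s denote the number of nonzero off-diagonal entries of Θ₀ and set c_L := 8L². Suppose the tuning parameter λ satisfies 2λ₀ ≤ λ ≤ 1/(8 L c_L) and 8 c_L² s λ² + 8 c_L p λ₀² ≤ λ₀/(2L). Let Θ̂ be a minimizer of Θ ↦ trace(Σ̂Θ) − log det(Θ) + λ‖Θ⁻‖₁ over the set of symmetric positive definite p×p matrices. Then ‖Θ̂ − Θ₀‖_F²/c_L + λ‖Θ̂⁻ − Θ₀⁻‖₁ ≤ 8 c_L² s λ² + 8 c_L p λ₀², and moreover |||Θ̂ − Θ₀|||₁ ≤ 16 c_L² (p + s) λ. -/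

import Mathlib

open Matrix
open scoped BigOperators

/-- Entrywise supremum norm of a matrix. -/
noncomputable def supNorm {p : ℕ} (A : Matrix (Fin p) (Fin p) ℝ) : ℝ :=
  ⨆ i, ⨆ j, |A i j|

/-- ℓ1-operator norm (maximum column ℓ1-norm) of a matrix. -/
noncomputable def opNorm1 {p : ℕ} (A : Matrix (Fin p) (Fin p) ℝ) : ℝ :=
  ⨆ j, ∑ i, |A i j|

/-- Frobenius norm of a matrix. -/
noncomputable def frobNorm {p : ℕ} (A : Matrix (Fin p) (Fin p) ℝ) : ℝ :=
  Real.sqrt (∑ i, ∑ j, (A i j) ^ 2)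

/-- ℓ1-norm of the off-diagonal part of a matrix: `‖A⁻‖₁ = Σ_{i≠j} |A_{ij}|`. -/
noncomputable def offL1 {p : ℕ} (A : Matrix (Fin p) (Fin p) ℝ) : ℝ :=
  ∑ i, ∑ j, if i = j then 0 else |A i j|

/-- The graphical Lasso objective `Θ ↦ trace(Σ̂Θ) − log det Θ + λ‖Θ⁻‖₁`. -/
noncomputable def glassoObj {p : ℕ} (Shat : Matrix (Fin p) (Fin p) ℝ) (lam : ℝ)
    (Θ : Matrix (Fin p) (Fin p) ℝ) : ℝ :=
  (Shat * Θ).trace - Real.log Θ.det + lam * offL1 Θ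

lemma log_one_add_le_sub_sq_div {x : ℝ} (hx : -1 < x) :
    Real.log (1 + x) ≤ x - x ^ 2 / (2 * (1 + |x|)) := by
  have hy : 0 < 1 + x := by linarith
  rcases le_total 0 x with h | h
  · have h1 : Real.log (1 + x) ≤ Real.sinh (Real.log (1 + x)) :=
      Real.self_le_sinh_iff.2 (Real.log_nonneg (by linarith))
    rw [Real.sinh_log hy] at h1
    rw [abs_of_nonneg h]
    refine h1.trans (le_of_eq ?_)
    field_simp
    ring
  · have h1 := Real.le_log_one_add_of_nonneg (x := -x / (1 + x))
      (div_nonneg (by linarith) hy.le)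
    have h2 : 1 + -x / (1 + x) = (1 + x)⁻¹ := by field_simp; ring
    have h3 : 2 * (-x / (1 + x)) / (-x / (1 + x) + 2) = -x + x ^ 2 / (2 + x) := by
      have : 2 + x ≠ 0 := by linarith
      have h5 : -x / (1 + x) + 2 = (2 + x) / (1 + x) := by field_simp; ring
      rw [h5]
      field_simp
      ring
    rw [h2, Real.log_inv, h3] at h1
    have h4 : x ^ 2 / (2 * (1 + |x|)) ≤ x ^ 2 / (2 + x) := by
      rw [abs_of_nonpos h]
      exact div_le_div_of_nonneg_left (sq_nonneg x) (by linarith) (by linarith)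
    linarith

lemma trace_mul_self_of_isHermitian {n : Type*} [Fintype n] {M : Matrix n n ℝ} (hM : M.IsHermitian) :
    (M * M).trace = ∑ i, ∑ j, M i j ^ 2 := by
  simp only [trace, diag_apply, mul_apply]
  refine Finset.sum_congr rfl fun i _ => Finset.sum_congr rfl fun j _ => ?_
  rw [sq, ← hM.apply i j]
  simp

lemma sum_sq_transpose_mul_mul {n : Type*} [Fintype n] [DecidableEq n] {M U : Matrix n n ℝ}
    (hM : M.IsHermitian) (hU : U * Uᵀ = 1) :
    ∑ i, ∑ j, (Uᵀ * M * U) i j ^ 2 = ∑ i, ∑ j, M i j ^ 2 := by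
  have hM' : (Uᵀ * M * U).IsHermitian := by
    simpa using isHermitian_conjTranspose_mul_mul U hM
  rw [← trace_mul_self_of_isHermitian hM, ← trace_mul_self_of_isHermitian hM']
  calc (Uᵀ * M * U * (Uᵀ * M * U)).trace = (Uᵀ * (M * (U * Uᵀ) * M * U)).trace := by
        simp only [Matrix.mul_assoc]
    _ = (M * M).trace := by
        rw [hU, trace_mul_comm]; simp only [Matrix.mul_assoc, Matrix.mul_one, hU]

lemma exists_orthogonal_diagonal {n : Type*} [Fintype n] [DecidableEq n] {M : Matrix n n ℝ}
    (hM : M.IsHermitian) :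
    ∃ U : Matrix n n ℝ, Uᵀ * U = 1 ∧ U * Uᵀ = 1 ∧ Uᵀ * M * U = diagonal hM.eigenvalues := by
  refine ⟨hM.eigenvectorUnitary, ?_, ?_, ?_⟩
  · simpa [star_eq_conjTranspose] using Unitary.coe_star_mul_self hM.eigenvectorUnitary
  · simpa [star_eq_conjTranspose] using Unitary.coe_mul_star_self hM.eigenvectorUnitary
  · have h := hM.conjStarAlgAut_star_eigenvectorUnitary
    rw [Unitary.conjStarAlgAut_apply] at h
    simpa [star_eq_conjTranspose, Function.comp_def] using h

lemma trace_sub_one_sub_log_det_ge {n : Type*} [Fintype n] [DecidableEq n] {W : Matrix n n ℝ}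
    (hW : W.PosDef) {t : ℝ} (ht : 0 ≤ t) (hT : ∑ i, ∑ j, (W - 1) i j ^ 2 ≤ t ^ 2) :
    (∑ i, ∑ j, (W - 1) i j ^ 2) / (2 * (1 + t)) ≤ (W - 1).trace - Real.log W.det := by
  have hH := hW.isHermitian
  set ν := hH.eigenvalues with hν
  obtain ⟨U, hU1, hU2, hUW⟩ := exists_orthogonal_diagonal hH
  have hD : Uᵀ * (W - 1) * U = diagonal fun i => ν i - 1 := by
    rw [Matrix.mul_sub, Matrix.sub_mul, hUW, Matrix.mul_one, hU1, ← diagonal_one, diagonal_sub]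
  have htr : (W - 1).trace = ∑ i, (ν i - 1) := by
    rw [← trace_diagonal, ← hD, trace_mul_comm, ← Matrix.mul_assoc, hU2, Matrix.one_mul]
  have hsq : ∑ i, ∑ j, (W - 1) i j ^ 2 = ∑ i, (ν i - 1) ^ 2 := by
    rw [← sum_sq_transpose_mul_mul (hH.sub isHermitian_one) hU2, hD]
    refine Finset.sum_congr rfl fun i _ => ?_
    rw [Finset.sum_eq_single i (fun j _ hj => by simp [diagonal_apply_ne' _ hj]) (by simp)]
    simp
  have hpos : ∀ i, 0 < ν i := hW.eigenvalues_pos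
  have hdet : Real.log W.det = ∑ i, Real.log (ν i) := by
    rw [hH.det_eq_prod_eigenvalues, ← Real.log_prod (fun i _ => (hpos i).ne')]
    simp [hν]
  have hle : ∀ i, |ν i - 1| ≤ t := fun i => by
    refine abs_le_of_sq_le_sq ?_ ht
    refine le_trans ?_ (hsq ▸ hT)
    exact Finset.single_le_sum (f := fun i => (ν i - 1) ^ 2) (fun _ _ => sq_nonneg _)
      (Finset.mem_univ i)
  rw [hsq, htr, hdet, ← Finset.sum_sub_distrib, Finset.sum_div]
  refine Finset.sum_le_sum fun i _ => ?_
  have h1 := log_one_add_le_sub_sq_div (x := ν i - 1) (by linarith [hpos i])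
  have h2 : (ν i - 1) ^ 2 / (2 * (1 + t)) ≤ (ν i - 1) ^ 2 / (2 * (1 + |ν i - 1|)) := by
    have := hle i
    exact div_le_div_of_nonneg_left (sq_nonneg _) (by positivity) (by linarith)
  rw [add_sub_cancel] at h1
  linarith

lemma stein_loss_ge {n : Type*} [Fintype n] [DecidableEq n] {Θ₀ Θ : Matrix n n ℝ}
    (hΘ₀ : Θ₀.PosDef) (hΘ : Θ.PosDef) {L : ℝ} (hL : 0 < L)
    (heig : ∀ i, 1 / L ≤ hΘ₀.isHermitian.eigenvalues i ∧ hΘ₀.isHermitian.eigenvalues i ≤ L)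
    {D : ℝ} (hD : 0 ≤ D) (hDsq : D ^ 2 = ∑ i, ∑ j, (Θ - Θ₀) i j ^ 2) :
    D ^ 2 / (2 * L ^ 2 * (1 + L * D)) ≤
      (Θ₀⁻¹ * (Θ - Θ₀)).trace - (Real.log Θ.det - Real.log Θ₀.det) := by
  obtain ⟨U, hU1, hU2, hUd⟩ := exists_orthogonal_diagonal hΘ₀.isHermitian
  set d := hΘ₀.isHermitian.eigenvalues
  have hd : ∀ i, 0 < d i := hΘ₀.eigenvalues_pos
  set R : Matrix n n ℝ := diagonal fun i => (√(d i))⁻¹ with hR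
  set B := R * Uᵀ with hB
  have hBt : Bᵀ = U * R := by simp [hB, hR]
  have hBΘ₀ : B * Θ₀ * Bᵀ = 1 := by
    have : B * Θ₀ * Bᵀ = R * (Uᵀ * Θ₀ * U) * R := by
      rw [hBt, hB]; simp only [Matrix.mul_assoc]
    rw [this, hUd, hR, diagonal_mul_diagonal, diagonal_mul_diagonal, ← diagonal_one]
    congr 1
    ext i
    have h1 := Real.sqrt_pos.2 (hd i)
    have h2 := Real.mul_self_sqrt (hd i).le
    field_simp
    linarith
  have hdetB : B.det ^ 2 * Θ₀.det = 1 := by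
    have := congrArg det hBΘ₀
    rw [det_mul, det_mul, det_transpose, det_one] at this
    linarith
  have hinv : Θ₀⁻¹ = Bᵀ * B := by
    have h1 : Θ₀ * Bᵀ * B = 1 := by
      rw [mul_eq_one_comm, ← Matrix.mul_assoc]; exact hBΘ₀
    exact inv_eq_right_inv (by rw [← Matrix.mul_assoc]; exact h1)
  set W := B * Θ * Bᵀ with hW
  have hBdet : B.det ≠ 0 := fun h => by simp [h] at hdetB
  have hWpd : W.PosDef := by
    have := hΘ.mul_mul_conjTranspose_same (B := B)
      (vecMul_injective_of_isUnit ((isUnit_iff_isUnit_det _).2 hBdet.isUnit))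
    simpa using this
  have hW1 : W - 1 = B * (Θ - Θ₀) * Bᵀ := by
    rw [Matrix.mul_sub, Matrix.sub_mul, hBΘ₀]
  have htr : (W - 1).trace = (Θ₀⁻¹ * (Θ - Θ₀)).trace := by
    rw [hW1, hinv, trace_mul_comm, ← Matrix.mul_assoc]
  have hlog : Real.log W.det = Real.log Θ.det - Real.log Θ₀.det := by
    have h1 : W.det = B.det ^ 2 * Θ.det := by
      rw [hW, det_mul, det_mul, det_transpose]; ring
    have h2 : W.det = Θ.det / Θ₀.det := by
      rw [h1, eq_div_iff hΘ₀.det_pos.ne']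
      linear_combination Θ.det * hdetB
    rw [h2, Real.log_div hΘ.det_pos.ne' hΘ₀.det_pos.ne']
  have hent : ∀ i j, (W - 1) i j ^ 2 = (Uᵀ * (Θ - Θ₀) * U) i j ^ 2 * ((d i)⁻¹ * (d j)⁻¹) := by
    intro i j
    have h1 : W - 1 = R * (Uᵀ * (Θ - Θ₀) * U) * R := by
      rw [hW1, hBt, hB]; simp only [Matrix.mul_assoc]
    rw [h1, hR, mul_diagonal, diagonal_mul, mul_pow, mul_pow, inv_pow, inv_pow,
      Real.sq_sqrt (hd i).le, Real.sq_sqrt (hd j).le]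
    ring
  rw [← sum_sq_transpose_mul_mul (hΘ.isHermitian.sub hΘ₀.isHermitian) hU2] at hDsq
  have hlow : ∀ i, L⁻¹ ≤ (d i)⁻¹ := fun i => inv_anti₀ (hd i) (heig i).2
  have hupp : ∀ i, (d i)⁻¹ ≤ L := fun i => by
    have := (heig i).1
    rw [one_div] at this
    exact inv_le_of_inv_le₀ hL this
  have hT1 : D ^ 2 / L ^ 2 ≤ ∑ i, ∑ j, (W - 1) i j ^ 2 := by
    rw [hDsq, Finset.sum_div]
    refine Finset.sum_le_sum fun i _ => ?_
    rw [Finset.sum_div]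
    refine Finset.sum_le_sum fun j _ => ?_
    rw [hent, div_eq_mul_inv, ← inv_pow, sq L⁻¹]
    have := hlow i
    have := hlow j
    have := hd i
    gcongr
  have hT2 : ∑ i, ∑ j, (W - 1) i j ^ 2 ≤ (L * D) ^ 2 := by
    rw [mul_pow, hDsq, Finset.mul_sum]
    refine Finset.sum_le_sum fun i _ => ?_
    rw [Finset.mul_sum]
    refine Finset.sum_le_sum fun j _ => ?_
    rw [hent, mul_comm, sq L]
    have := hupp i
    have := hupp j
    have := hd i
    have := hd j
    gcongr
  have key := trace_sub_one_sub_log_det_ge hWpd (by positivity) hT2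
  rw [htr, hlog] at key
  refine le_trans ?_ key
  calc D ^ 2 / (2 * L ^ 2 * (1 + L * D)) = D ^ 2 / L ^ 2 / (2 * (1 + L * D)) := by
        field_simp
    _ ≤ _ := by gcongr

lemma frobNorm_sq {p : ℕ} (A : Matrix (Fin p) (Fin p) ℝ) :
    frobNorm A ^ 2 = ∑ i, ∑ j, A i j ^ 2 :=
  Real.sq_sqrt (Finset.sum_nonneg fun _ _ => Finset.sum_nonneg fun _ _ => sq_nonneg _)

lemma frobNorm_nonneg {p : ℕ} (A : Matrix (Fin p) (Fin p) ℝ) : 0 ≤ frobNorm A :=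
  Real.sqrt_nonneg _

lemma abs_apply_le_supNorm {p : ℕ} (A : Matrix (Fin p) (Fin p) ℝ) (i j : Fin p) :
    |A i j| ≤ supNorm A :=
  (le_ciSup (f := fun j => |A i j|) (Set.finite_range _).bddAbove j).trans
    (le_ciSup (f := fun i => ⨆ j, |A i j|) (Set.finite_range _).bddAbove i)

lemma sum_abs_diag_le {p : ℕ} (A : Matrix (Fin p) (Fin p) ℝ) :
    ∑ i, |A i i| ≤ √p * frobNorm A := by
  refine abs_le_of_sq_le_sq' ?_ (mul_nonneg (Real.sqrt_nonneg _) (frobNorm_nonneg A)) |>.2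
  rw [mul_pow, Real.sq_sqrt p.cast_nonneg, frobNorm_sq]
  refine sq_sum_le_card_mul_sum_sq.trans ?_
  rw [Finset.card_univ, Fintype.card_fin]
  refine mul_le_mul_of_nonneg_left (Finset.sum_le_sum fun i _ => ?_) p.cast_nonneg
  rw [sq_abs]
  exact Finset.single_le_sum (f := fun j => A i j ^ 2) (fun _ _ => sq_nonneg _) (Finset.mem_univ i)

lemma sum_abs_eq_offL1_add_diag {p : ℕ} (A : Matrix (Fin p) (Fin p) ℝ) :
    ∑ i, ∑ j, |A i j| = offL1 A + ∑ i, |A i i| := by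
  rw [offL1, ← Finset.sum_add_distrib]
  refine Finset.sum_congr rfl fun i _ => ?_
  have : |A i i| = ∑ j, if i = j then |A i j| else 0 := by simp
  rw [this, ← Finset.sum_add_distrib]
  refine Finset.sum_congr rfl fun j _ => ?_
  split_ifs <;> simp

lemma neg_trace_mul_le {p : ℕ} (A B : Matrix (Fin p) (Fin p) ℝ) (hB : B.IsHermitian) :
    -(A * B).trace ≤ supNorm A * (offL1 B + √p * frobNorm B) := by
  rcases isEmpty_or_nonempty (Fin p) with h | ⟨⟨i₀⟩⟩
  · simp [trace, supNorm]
  have hA : 0 ≤ supNorm A := (abs_nonneg _).trans (abs_apply_le_supNorm A i₀ i₀)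
  calc -(A * B).trace ≤ ∑ i, ∑ j, supNorm A * |B i j| := by
        simp only [trace, diag_apply, mul_apply, ← Finset.sum_neg_distrib]
        refine Finset.sum_le_sum fun i _ => Finset.sum_le_sum fun j _ => ?_
        have hs : B j i = B i j := by simpa using hB.apply i j
        rw [hs]
        refine (neg_le_abs _).trans ?_
        rw [abs_mul]
        exact mul_le_mul_of_nonneg_right (abs_apply_le_supNorm A i j) (abs_nonneg _)
    _ = supNorm A * (offL1 B + ∑ i, |B i i|) := by
        simp only [← Finset.mul_sum, sum_abs_eq_offL1_add_diag]
    _ ≤ _ := mul_le_mul_of_nonneg_left (by linarith [sum_abs_diag_le B]) hA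

lemma offL1_add_offL1_sub_le {p : ℕ} (A B : Matrix (Fin p) (Fin p) ℝ) :
    offL1 A + offL1 (B - A) ≤ offL1 B +
      2 * (√({ij : Fin p × Fin p | ij.1 ≠ ij.2 ∧ A ij.1 ij.2 ≠ 0}.ncard) * frobNorm (B - A)) := by
  classical
  set S : Finset (Fin p × Fin p) := {ij | ij.1 ≠ ij.2 ∧ A ij.1 ij.2 ≠ 0} with hS
  have hcard : {ij : Fin p × Fin p | ij.1 ≠ ij.2 ∧ A ij.1 ij.2 ≠ 0}.ncard = S.card := by
    rw [← Set.ncard_coe_finset, hS]; simp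
  have hcs : ∑ ij ∈ S, |(B - A) ij.1 ij.2| ≤ √(S.card : ℝ) * frobNorm (B - A) := by
    refine abs_le_of_sq_le_sq' ?_ (mul_nonneg (Real.sqrt_nonneg _) (frobNorm_nonneg _)) |>.2
    rw [mul_pow, Real.sq_sqrt (Nat.cast_nonneg _), frobNorm_sq]
    refine sq_sum_le_card_mul_sum_sq.trans ?_
    refine mul_le_mul_of_nonneg_left ?_ (Nat.cast_nonneg _)
    rw [← Fintype.sum_prod_type']
    simp only [sq_abs]
    exact Finset.sum_le_sum_of_subset_of_nonneg (Finset.subset_univ _) fun _ _ _ => sq_nonneg _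
  rw [hcard]
  refine le_trans ?_ (add_le_add_right (mul_le_mul_of_nonneg_left hcs zero_le_two) _)
  rw [hS, Finset.sum_filter, Fintype.sum_prod_type]
  simp only [offL1, Finset.mul_sum, ← Finset.sum_add_distrib]
  refine Finset.sum_le_sum fun i _ => Finset.sum_le_sum fun j _ => ?_
  by_cases hij : i = j
  · simp [hij]
  by_cases hA : A i j = 0
  · simp [hij, hA]
  · simp only [hij, hA, if_false, ne_eq, not_false_eq_true, and_self, if_true, Matrix.sub_apply]
    have h1 : |A i j| ≤ |B i j| + |B i j - A i j| := by
      simpa using abs_sub (B i j) (B i j - A i j)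
    linarith

lemma opNorm1_le {p : ℕ} (hp : 1 ≤ p) (A : Matrix (Fin p) (Fin p) ℝ) :
    opNorm1 A ≤ offL1 A + frobNorm A := by
  have : Nonempty (Fin p) := ⟨⟨0, hp⟩⟩
  refine ciSup_le fun j => ?_
  have h1 : |A j j| ≤ frobNorm A := by
    refine abs_le_of_sq_le_sq ?_ (frobNorm_nonneg A)
    rw [frobNorm_sq]
    exact (Finset.single_le_sum (f := fun k => A j k ^ 2) (fun _ _ => sq_nonneg _)
      (Finset.mem_univ j)).trans (Finset.single_le_sum (f := fun i => ∑ k, A i k ^ 2)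
        (fun _ _ => Finset.sum_nonneg fun _ _ => sq_nonneg _) (Finset.mem_univ j))
  have h2 : ∑ i, |A i j| = (∑ i, if i = j then 0 else |A i j|) + |A j j| := by
    have : |A j j| = ∑ i, if i = j then |A i j| else 0 := by simp
    rw [this, ← Finset.sum_add_distrib]
    refine Finset.sum_congr rfl fun i _ => ?_
    split_ifs <;> simp
  have h3 : (∑ i, if i = j then 0 else |A i j|) ≤ offL1 A := by
    refine Finset.sum_le_sum fun i _ => ?_
    exact Finset.single_le_sum (f := fun k => if i = k then 0 else |A i k|)
      (fun k _ => by positivity) (Finset.mem_univ j)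
  linarith

lemma offL1_nonneg {p : ℕ} (A : Matrix (Fin p) (Fin p) ℝ) : 0 ≤ offL1 A :=
  Finset.sum_nonneg fun _ _ => Finset.sum_nonneg fun _ _ => by positivity

/-- The scalar localisation argument: a margin bound that is quadratic near zero and linear far
away, combined with a linear upper bound of small slope, gives the oracle rate. -/
lemma oracle_rate_of_margin {L lam lam0 D X f s p : ℝ} (hL : 1 ≤ L) (hs : 0 ≤ s) (hp : 0 ≤ p)
    (hD : 0 ≤ D) (hX : 0 ≤ X) (hlam0 : 0 < lam0) (hlam1 : 2 * lam0 ≤ lam)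
    (hlam2 : lam ≤ 1 / (64 * L ^ 3))
    (hlam3 : 512 * L ^ 4 * s * lam ^ 2 + 64 * L ^ 2 * p * lam0 ^ 2 ≤ lam0 / (2 * L))
    (hmargin : D ^ 2 / (2 * L ^ 2 * (1 + L * D)) ≤ f)
    (hf : f + lam * X ≤ 2 * lam * (√s * D) + lam0 * (X + √p * D)) :
    D ^ 2 / (8 * L ^ 2) + lam * X ≤ 64 * L ^ 2 * s * lam ^ 2 + 16 * L ^ 2 * p * lam0 ^ 2 := by
  have hL0 : 0 < L := by linarith
  have hlam : 0 < lam := by linarith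
  set K := 4 * lam * √s + 2 * lam0 * √p with hK
  have hK0 : 0 ≤ K := by positivity
  have hmain : 2 * f + lam * X ≤ K * D := by
    have := mul_le_mul_of_nonneg_right hlam1 hX
    rw [hK]; linarith
  have hKsq : K ^ 2 ≤ 32 * s * lam ^ 2 + 8 * p * lam0 ^ 2 := by
    have h1 := Real.sq_sqrt hs
    have h2 := Real.sq_sqrt hp
    have h3 : 32 * s * lam ^ 2 + 8 * p * lam0 ^ 2 =
        2 * (4 * lam * √s) ^ 2 + 2 * (2 * lam0 * √p) ^ 2 := by
      rw [mul_pow, mul_pow, mul_pow, mul_pow, h1, h2]; ring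
    rw [h3, hK]
    linarith [sq_nonneg (4 * lam * √s - 2 * lam0 * √p)]
  have hLD : L * D ≤ 1 := by
    by_contra! hlt
    have hDpos : 0 < D := pos_of_mul_pos_right (by linarith) hL0.le
    have h1 : D / (4 * L ^ 3) ≤ D ^ 2 / (2 * L ^ 2 * (1 + L * D)) := by
      rw [div_le_div_iff₀ (by positivity) (by positivity)]
      have : 0 ≤ L ^ 2 * D * (L * D - 1) := by
        have : 0 ≤ L * D - 1 := by linarith
        positivity
      linarith
    have h2 : D / (2 * L ^ 3) ≤ K * D := by
      have : D / (2 * L ^ 3) = 2 * (D / (4 * L ^ 3)) := by field_simp; norm_num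
      have := mul_nonneg hlam.le hX
      linarith
    have h3 : 1 / (2 * L ^ 3) ≤ K := by
      refine le_of_mul_le_mul_right ?_ hDpos
      rwa [one_div_mul_eq_div]
    have h4 : (1 / (2 * L ^ 3)) ^ 2 ≤ K ^ 2 := pow_le_pow_left₀ (by positivity) h3 2
    have h5 : 8 * L ^ 2 * K ^ 2 ≤ lam0 / (2 * L) := by
      refine le_trans ?_ hlam3
      have : 8 * L ^ 2 * K ^ 2 ≤ 8 * L ^ 2 * (32 * s * lam ^ 2 + 8 * p * lam0 ^ 2) := by gcongr
      have : 256 * L ^ 2 * (s * lam ^ 2) ≤ 512 * L ^ 4 * (s * lam ^ 2) := by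
        have : L ^ 2 ≤ L ^ 4 := pow_le_pow_right₀ hL (by norm_num)
        gcongr; norm_num
      linarith
    have h6 : lam0 / (2 * L) ≤ 1 / (256 * L ^ 4) := by
      have : lam0 ≤ 1 / (128 * L ^ 3) := by
        have : 1 / (128 * L ^ 3) = 1 / (64 * L ^ 3) / 2 := by field_simp; norm_num
        linarith
      calc lam0 / (2 * L) ≤ 1 / (128 * L ^ 3) / (2 * L) := by gcongr
        _ = _ := by field_simp; norm_num
    have h7 : 8 * L ^ 2 * (1 / (2 * L ^ 3)) ^ 2 = 512 * (1 / (256 * L ^ 4)) := by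
      field_simp; norm_num
    have h8 : 0 < 1 / (256 * L ^ 4) := by positivity
    have h9 : 8 * L ^ 2 * (1 / (2 * L ^ 3)) ^ 2 ≤ 8 * L ^ 2 * K ^ 2 := by gcongr
    linarith
  have hquad : D ^ 2 / (4 * L ^ 2) ≤ f := by
    refine le_trans ?_ hmargin
    refine div_le_div_of_nonneg_left (sq_nonneg D) (by positivity) ?_
    have : 0 ≤ 2 * L ^ 2 * (1 - L * D) := by
      have : 0 ≤ 1 - L * D := by linarith
      positivity
    linarith
  have hyoung : K * D ≤ 3 * (D ^ 2 / (8 * L ^ 2)) + 2 * L ^ 2 * K ^ 2 := by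
    have h1 : 3 * (D ^ 2 / (8 * L ^ 2)) + 2 * L ^ 2 * K ^ 2 - K * D =
        (D / (2 * L) - L * K) ^ 2 + D ^ 2 / (8 * L ^ 2) + L ^ 2 * K ^ 2 := by
      field_simp; ring
    have : 0 ≤ (D / (2 * L) - L * K) ^ 2 + D ^ 2 / (8 * L ^ 2) + L ^ 2 * K ^ 2 := by positivity
    linarith
  have h1 : D ^ 2 / (4 * L ^ 2) = 2 * (D ^ 2 / (8 * L ^ 2)) := by field_simp; ring
  have h2 : 2 * L ^ 2 * K ^ 2 ≤ 2 * L ^ 2 * (32 * s * lam ^ 2 + 8 * p * lam0 ^ 2) := by gcongr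
  linarith

/-- oracle inequality for the graphical Lasso, regime `p ≪ n`.
`S₀` is `Σ₀`, `Shat` is `Σ̂`, `Θhat` is the graphical Lasso estimator `Θ̂`,
`s` the number of nonzero off-diagonal entries of `Θ₀ := Σ₀⁻¹`, and `cL = 8L²`. -/
theorem stmt0 {p : ℕ} (hp : 1 ≤ p) (L lam lam0 : ℝ) (hL : 1 ≤ L)
    (S₀ Shat Θhat : Matrix (Fin p) (Fin p) ℝ)
    (hS₀pd : S₀.PosDef)
    (Θ₀ : Matrix (Fin p) (Fin p) ℝ) (hΘ₀ : Θ₀ = S₀⁻¹)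
    (hΘ₀pd : Θ₀.PosDef)
    (heig : ∀ i, 1 / L ≤ hΘ₀pd.isHermitian.eigenvalues i ∧
      hΘ₀pd.isHermitian.eigenvalues i ≤ L)
    (hShat : Shat.IsHermitian)
    (hlam0 : 0 < lam0)
    (hclose : supNorm (Shat - S₀) ≤ lam0)
    (s : ℕ) (hs : s = {ij : Fin p × Fin p | ij.1 ≠ ij.2 ∧ Θ₀ ij.1 ij.2 ≠ 0}.ncard)
    (cL : ℝ) (hcL : cL = 8 * L ^ 2)
    (hlam1 : 2 * lam0 ≤ lam) (hlam2 : lam ≤ 1 / (8 * L * cL))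
    (hlam3 : 8 * cL ^ 2 * s * lam ^ 2 + 8 * cL * p * lam0 ^ 2 ≤ lam0 / (2 * L))
    (hΘhatpd : Θhat.PosDef)
    (hmin : ∀ Θ : Matrix (Fin p) (Fin p) ℝ, Θ.PosDef →
      glassoObj Shat lam Θhat ≤ glassoObj Shat lam Θ) :
    frobNorm (Θhat - Θ₀) ^ 2 / cL + lam * offL1 (Θhat - Θ₀) ≤
        8 * cL ^ 2 * s * lam ^ 2 + 8 * cL * p * lam0 ^ 2 ∧
    opNorm1 (Θhat - Θ₀) ≤ 16 * cL ^ 2 * (p + s) * lam := by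
  have hL0 : 0 < L := by linarith
  have hlampos : 0 < lam := by linarith
  set D := frobNorm (Θhat - Θ₀) with hD
  set X := offL1 (Θhat - Θ₀) with hX
  have hD0 : 0 ≤ D := frobNorm_nonneg _
  have hX0 : 0 ≤ X := offL1_nonneg _
  have hS₀ : Θ₀⁻¹ = S₀ := by
    rw [hΘ₀, nonsing_inv_nonsing_inv _ ((isUnit_iff_isUnit_det _).1 hS₀pd.isUnit)]
  have hmargin := stein_loss_ge hΘ₀pd hΘhatpd hL0 heig hD0 (frobNorm_sq _)
  rw [hS₀] at hmargin
  have hbasic : (S₀ * (Θhat - Θ₀)).trace - (Real.log Θhat.det - Real.log Θ₀.det) + lam * X ≤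
      2 * lam * (√s * D) + lam0 * (X + √p * D) := by
    have h1 := hmin Θ₀ hΘ₀pd
    have h2 := neg_trace_mul_le (Shat - S₀) (Θhat - Θ₀)
      (hΘhatpd.isHermitian.sub hΘ₀pd.isHermitian)
    have h3 := mul_le_mul_of_nonneg_left (offL1_add_offL1_sub_le Θ₀ Θhat) hlampos.le
    have h4 : supNorm (Shat - S₀) * (X + √p * D) ≤ lam0 * (X + √p * D) := by gcongr
    rw [← hs] at h3
    simp only [glassoObj] at h1
    simp only [Matrix.sub_mul, Matrix.mul_sub, trace_sub] at h2 ⊢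
    linarith
  have hrate := oracle_rate_of_margin hL s.cast_nonneg p.cast_nonneg hD0 hX0 hlam0 hlam1
    (hlam2.trans_eq (by rw [hcL]; ring)) (by rw [hcL] at hlam3; linarith) hmargin hbasic
  have hsn : (0 : ℝ) ≤ s := s.cast_nonneg
  have hpn : (1 : ℝ) ≤ p := by exact_mod_cast hp
  have hL2 : 1 ≤ L ^ 2 := one_le_pow₀ hL
  have hL4 : L ^ 2 ≤ L ^ 4 := pow_le_pow_right₀ hL (by norm_num)
  have hlam0sq : lam0 ^ 2 ≤ lam ^ 2 / 4 := by
    have : lam0 ^ 2 ≤ (lam / 2) ^ 2 := pow_le_pow_left₀ hlam0.le (by linarith) 2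
    linarith [div_pow lam 2 2]
  have hbound : 64 * L ^ 2 * s * lam ^ 2 + 16 * L ^ 2 * p * lam0 ^ 2 ≤
      64 * L ^ 2 * (p + s) * lam ^ 2 := by
    have h1 : 16 * L ^ 2 * p * lam0 ^ 2 ≤ 16 * L ^ 2 * p * (lam ^ 2 / 4) := by gcongr
    have h2 : 0 ≤ L ^ 2 * p * lam ^ 2 := by positivity
    linarith
  constructor
  · rw [hcL]
    refine hrate.trans ?_
    have h1 : 64 * L ^ 2 * (s * lam ^ 2) ≤ 512 * L ^ 4 * (s * lam ^ 2) := by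
      gcongr; norm_num
    have h2 : 0 ≤ L ^ 2 * p * lam0 ^ 2 := by positivity
    linarith
  · have hXle : X ≤ 64 * L ^ 2 * (p + s) * lam := by
      refine le_of_mul_le_mul_left ?_ hlampos
      have : 0 ≤ D ^ 2 / (8 * L ^ 2) := by positivity
      linarith
    have hDle : D ≤ 32 * L ^ 2 * (p + s) * lam := by
      refine le_trans (le_abs_self D) (abs_le_of_sq_le_sq ?_ (by positivity))
      have h1 : D ^ 2 / (8 * L ^ 2) ≤ 64 * L ^ 2 * (p + s) * lam ^ 2 := by
        have := mul_nonneg hlampos.le hX0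
        linarith
      rw [div_le_iff₀ (by positivity)] at h1
      have h2 : L ^ 4 * lam ^ 2 * (p + s) * 1 ≤ L ^ 4 * lam ^ 2 * (p + s) * (p + s : ℝ) := by
        gcongr; linarith
      have h3 : 0 ≤ L ^ 4 * lam ^ 2 * (p + s) := by positivity
      linarith
    refine (opNorm1_le hp _).trans ?_
    rw [hcL]
    have : L ^ 2 * ((p + s) * lam) ≤ L ^ 4 * ((p + s) * lam) := by gcongr
    have : 0 ≤ L ^ 2 * ((p + s) * lam) := by positivity
    linarith
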